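/- arXiv:2412.18950 — 2 statements merged into one kernel-verified Lean document; each statement's English description precedes it below -/
import Mathlib

section
/- Let u and h be controls, let q_u be the state for u and p_u its adjoint state, and for each s ∈ ℝ let q_{u+sh} denote the state for the control u + s h. Then the function s ↦ J(u + s h) is differentiable at s = 0 and its derivative equals ∫₀^{t_f} ⟨μ u(t) + Bᵀ p_u(t), h(t)⟩ dt, where ⟨·,·⟩ is the Euclidean inner product on ℝ^{n_c}. -/
open Matrix MeasureTheory

theorem Matrix.continuousOn_mulVec {k l : Type*} [Fintype l] {s : Set ℝ}
    (M : Matrix k l ℝ) {f : ℝ → l → ℝ} (hf : ContinuousOn f s) :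
    ContinuousOn (fun t => M *ᵥ f t) s :=
  (continuous_const.matrix_mulVec continuous_id).comp_continuousOn hf

theorem ContinuousOn.dotProduct_real {l : Type*} [Fintype l] {s : Set ℝ}
    {f g : ℝ → l → ℝ} (hf : ContinuousOn f s) (hg : ContinuousOn g s) :
    ContinuousOn (fun t => f t ⬝ᵥ g t) s :=
  (continuous_fst.dotProduct continuous_snd).comp_continuousOn (hf.prodMk hg)

theorem HasDerivAt.dotProduct_real {l : Type*} [Fintype l] {f g : ℝ → l → ℝ}
    {f' g' : l → ℝ} {t : ℝ} (hf : HasDerivAt f f' t) (hg : HasDerivAt g g' t) :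
    HasDerivAt (fun t => f t ⬝ᵥ g t) (f' ⬝ᵥ g t + f t ⬝ᵥ g') t := by
  simp only [dotProduct, ← Finset.sum_add_distrib]
  exact HasDerivAt.fun_sum fun i _ => (hasDerivAt_pi.1 hf i).fun_mul (hasDerivAt_pi.1 hg i)

/-- Solutions of `q' = A q + f` on `[a, b]` are determined by their initial value. -/
theorem Matrix.eqOn_Icc_of_hasDerivAt_mulVec_add {l : Type*} [Fintype l] {a b : ℝ}
    (A : Matrix l l ℝ) {f q r : ℝ → l → ℝ}
    (hq : ∀ t ∈ Set.Icc a b, HasDerivAt q (A *ᵥ q t + f t) t)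
    (hr : ∀ t ∈ Set.Icc a b, HasDerivAt r (A *ᵥ r t + f t) t)
    (h : q a = r a) : Set.EqOn q r (Set.Icc a b) := by
  let L : (l → ℝ) →L[ℝ] (l → ℝ) := A.mulVecLin.toContinuousLinearMap
  refine ODE_solution_unique (v := fun t x => L x + f t) (K := ‖L‖₊)
    (fun t => LipschitzWith.of_dist_le_mul fun x y => ?_)
    (HasDerivAt.continuousOn hq)
    (fun t ht => (hq t (Set.Ico_subset_Icc_self ht)).hasDerivWithinAt)
    (HasDerivAt.continuousOn hr)
    (fun t ht => (hr t (Set.Ico_subset_Icc_self ht)).hasDerivWithinAt) h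
  rw [dist_add_right]
  exact L.lipschitz.dist_le_mul x y

/-- The derivative at `0` of a quadratic polynomial is its linear coefficient. -/
theorem hasDerivAt_zero_quadratic (a b c : ℝ) :
    HasDerivAt (fun s : ℝ => a + s * b + s ^ 2 * c) b 0 := by
  simpa using (((hasDerivAt_id (0 : ℝ)).mul_const b).const_add a).fun_add
    (((hasDerivAt_id (0 : ℝ)).fun_pow 2).mul_const c)

/-- For the full-order linear-quadratic optimal control problem,
the map `s ↦ J(u + s h)` is differentiable at `s = 0` with derivative
`∫₀^{t_f} ⟨μ u(t) + Bᵀ p_u(t), h(t)⟩ dt`, where `p_u` is the adjoint state of `u`.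
Vectors are modeled as functions `Fin m → ℝ`, the Euclidean inner product is `⬝ᵥ`
and `‖x‖² = x ⬝ᵥ x`. -/
theorem fom_cost_hasDerivAt
    (m nc : ℕ) (t_f : ℝ) (ht_f : 0 < t_f)
    (A : Matrix (Fin m) (Fin m) ℝ) (B : Matrix (Fin m) (Fin nc) ℝ)
    (C : Matrix (Fin m) (Fin m) ℝ) (μ : ℝ) (hμ : 0 < μ)
    (q0 : Fin m → ℝ) (qd : ℝ → Fin m → ℝ)
    (hqd : ContinuousOn qd (Set.Icc (0:ℝ) t_f))
    -- the controls `u` and `h`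
    (u h : ℝ → Fin nc → ℝ)
    (hu : ContinuousOn u (Set.Icc (0:ℝ) t_f))
    (hh : ContinuousOn h (Set.Icc (0:ℝ) t_f))
    -- for every `s`, `qs s` is the state corresponding to the control `u + s h`
    (qs : ℝ → ℝ → Fin m → ℝ)
    (hqs0 : ∀ s : ℝ, qs s 0 = q0)
    (hqsode : ∀ s : ℝ, ∀ t ∈ Set.Icc (0:ℝ) t_f,
      HasDerivAt (qs s) (A *ᵥ qs s t + B *ᵥ (u t + s • h t)) t)
    -- `p` is the adjoint state corresponding to `u` (whose state is `qs 0`)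
    (p : ℝ → Fin m → ℝ)
    (hpf : p t_f = 0)
    (hpode : ∀ t ∈ Set.Icc (0:ℝ) t_f,
      HasDerivAt p (-(Aᵀ *ᵥ p t + (Cᵀ * C) *ᵥ (qs 0 t - qd t))) t) :
    HasDerivAt
      (fun s : ℝ =>
        (1/2) * ∫ t in (0:ℝ)..t_f,
          ((C *ᵥ (qs s t - qd t)) ⬝ᵥ (C *ᵥ (qs s t - qd t))
            + μ * ((u t + s • h t) ⬝ᵥ (u t + s • h t))))
      (∫ t in (0:ℝ)..t_f, (μ • u t + Bᵀ *ᵥ p t) ⬝ᵥ h t) 0 := by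
  set I := Set.Icc (0 : ℝ) t_f with hI
  have integrable_of : ∀ f : ℝ → ℝ, ContinuousOn f I → IntervalIntegrable f volume 0 t_f :=
    fun f hf => hf.intervalIntegrable_of_Icc ht_f.le
  let z : ℝ → Fin m → ℝ := fun t => qs 1 t - qs 0 t
  have hz : ∀ t ∈ I, HasDerivAt z (A *ᵥ z t + B *ᵥ h t) t := fun t ht => by
    refine ((hqsode 1 t ht).sub (hqsode 0 t ht)).congr_deriv ?_
    simp only [z, mulVec_sub, mulVec_add, one_smul, zero_smul, mulVec_zero]
    abel
  -- the state depends affinely on the control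
  have hstate : ∀ s, ∀ t ∈ I, qs s t = qs 0 t + s • z t := fun s => by
    refine A.eqOn_Icc_of_hasDerivAt_mulVec_add (hqsode s) (fun t ht => ?_) ?_
    · refine ((hqsode 0 t ht).add ((hz t ht).const_smul s)).congr_deriv ?_
      simp only [mulVec_add, mulVec_smul, smul_add, zero_smul, mulVec_zero]
      abel
    · simp [z, hqs0]
  have hqc : ContinuousOn (qs 0) I := HasDerivAt.continuousOn (hqsode 0)
  have hzc : ContinuousOn z I := HasDerivAt.continuousOn hz
  have hpc : ContinuousOn p I := HasDerivAt.continuousOn hpode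
  let e : ℝ → Fin m → ℝ := fun t => C *ᵥ (qs 0 t - qd t)
  let w : ℝ → Fin m → ℝ := fun t => C *ᵥ z t
  have hec : ContinuousOn e I := C.continuousOn_mulVec (hqc.sub hqd)
  have hwc : ContinuousOn w I := C.continuousOn_mulVec hzc
  let a : ℝ → ℝ := fun t => e t ⬝ᵥ e t + μ * (u t ⬝ᵥ u t)
  let b : ℝ → ℝ := fun t => e t ⬝ᵥ w t + μ * (u t ⬝ᵥ h t)
  let c : ℝ → ℝ := fun t => w t ⬝ᵥ w t + μ * (h t ⬝ᵥ h t)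
  have ha := integrable_of a
    ((hec.dotProduct_real hec).add (continuousOn_const.mul (hu.dotProduct_real hu)))
  have hb := integrable_of b
    ((hec.dotProduct_real hwc).add (continuousOn_const.mul (hu.dotProduct_real hh)))
  have hc := integrable_of c
    ((hwc.dotProduct_real hwc).add (continuousOn_const.mul (hh.dotProduct_real hh)))
  have hcost : ∀ s : ℝ, (1 / 2) * ∫ t in (0:ℝ)..t_f,
      ((C *ᵥ (qs s t - qd t)) ⬝ᵥ (C *ᵥ (qs s t - qd t))
        + μ * ((u t + s • h t) ⬝ᵥ (u t + s • h t)))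
      = (1 / 2) * (∫ t in (0:ℝ)..t_f, a t) + s * (∫ t in (0:ℝ)..t_f, b t)
        + s ^ 2 * ((1 / 2) * ∫ t in (0:ℝ)..t_f, c t) := fun s => by
    have hcongr : ∀ t ∈ Set.uIcc 0 t_f, (C *ᵥ (qs s t - qd t)) ⬝ᵥ (C *ᵥ (qs s t - qd t))
        + μ * ((u t + s • h t) ⬝ᵥ (u t + s • h t))
        = a t + (2 * s) * b t + s ^ 2 * c t := fun t ht => by
      rw [Set.uIcc_of_le ht_f.le] at ht
      have hCe : C *ᵥ (qs s t - qd t) = e t + s • w t := by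
        rw [hstate s t ht, add_sub_right_comm, mulVec_add, mulVec_smul]
      simp only [hCe, a, b, c, add_dotProduct, dotProduct_add, smul_dotProduct, dotProduct_smul,
        smul_eq_mul, dotProduct_comm (w t) (e t), dotProduct_comm (h t) (u t)]
      ring
    rw [intervalIntegral.integral_congr hcongr,
      intervalIntegral.integral_add (ha.add (hb.const_mul _)) (hc.const_mul _),
      intervalIntegral.integral_add ha (hb.const_mul _),
      intervalIntegral.integral_const_mul, intervalIntegral.integral_const_mul]
    ring
  -- integrate the derivative of `p ⬝ᵥ z`, which vanishes at both ends
  have hpz : ∀ t ∈ Set.uIcc 0 t_f, HasDerivAt (fun t => p t ⬝ᵥ z t)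
      ((μ • u t + Bᵀ *ᵥ p t) ⬝ᵥ h t - b t) t := fun t ht => by
    rw [Set.uIcc_of_le ht_f.le] at ht
    refine ((hpode t ht).dotProduct_real (hz t ht)).congr_deriv ?_
    have hA : (Aᵀ *ᵥ p t) ⬝ᵥ z t = p t ⬝ᵥ (A *ᵥ z t) := by
      rw [mulVec_transpose, dotProduct_mulVec]
    have hB : (Bᵀ *ᵥ p t) ⬝ᵥ h t = p t ⬝ᵥ (B *ᵥ h t) := by
      rw [mulVec_transpose, dotProduct_mulVec]
    have hC : ((Cᵀ * C) *ᵥ (qs 0 t - qd t)) ⬝ᵥ z t = e t ⬝ᵥ w t := by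
      rw [← mulVec_mulVec, mulVec_transpose, ← dotProduct_mulVec]
    simp only [b, neg_dotProduct, add_dotProduct, dotProduct_add, smul_dotProduct, smul_eq_mul,
      hA, hB, hC]
    ring
  have hg := integrable_of (fun t => (μ • u t + Bᵀ *ᵥ p t) ⬝ᵥ h t)
    (((hu.const_smul μ).add (Bᵀ.continuousOn_mulVec hpc)).dotProduct_real hh)
  have hgb := intervalIntegral.integral_eq_sub_of_hasDerivAt hpz (hg.sub hb)
  rw [intervalIntegral.integral_sub hg hb] at hgb
  have hz0 : z 0 = 0 := by simp [z, hqs0]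
  rw [hpf, hz0, zero_dotProduct, dotProduct_zero, sub_self, sub_eq_zero] at hgb
  rw [hgb, funext hcost]
  exact hasDerivAt_zero_quadratic _ _ _
end

section
/- If a control u* satisfies J(u*) ≤ J(u) for every control u, then the first-order necessary optimality condition μ u*(t) + Bᵀ p_{u*}(t) = 0 holds for every t ∈ [0, t_f]. -/
open Matrix MeasureTheory

section LinearODE

variable {E : Type*} [NormedAddCommGroup E] [NormedSpace ℝ E] [CompleteSpace E]

/-- The inhomogeneous linear equation `z' = T z + f` with continuous `f` has a global solution
vanishing at `0`, given by the variation of constants formula. -/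
theorem exists_hasDerivAt_linear_ode (T : E →L[ℝ] E) {f : ℝ → E} (hf : Continuous f) :
    ∃ z : ℝ → E, z 0 = 0 ∧ ∀ t, HasDerivAt z (T (z t) + f t) t := by
  have hexp : ∀ t : ℝ, HasDerivAt (fun s : ℝ => NormedSpace.exp (s • T))
      (T * NormedSpace.exp (t • T)) t := fun t => hasDerivAt_exp_smul_const' T t
  have hc : Continuous (fun s : ℝ => NormedSpace.exp (s • T)) :=
    continuous_iff_continuousAt.2 fun t => (hexp t).continuousAt
  have hg : Continuous (fun s : ℝ => NormedSpace.exp ((-s) • T) (f s)) :=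
    (hc.comp continuous_neg).clm_apply hf
  refine ⟨fun t => NormedSpace.exp (t • T) (∫ s in (0 : ℝ)..t, NormedSpace.exp ((-s) • T) (f s)),
    by simp, fun t => ?_⟩
  have hI := intervalIntegral.integral_hasDerivAt_right (hg.intervalIntegrable 0 t)
    (hg.stronglyMeasurableAtFilter _ _) hg.continuousAt
  have hinv : NormedSpace.exp (t • T) * NormedSpace.exp ((-t) • T) = 1 := by
    let _ : NormedAlgebra ℚ (E →L[ℝ] E) := NormedAlgebra.restrictScalars ℚ ℝ _
    rw [← NormedSpace.exp_add_of_commute, neg_smul, add_neg_cancel, NormedSpace.exp_zero]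
    exact ((Commute.refl T).smul_left t).smul_right (-t)
  convert (hexp t).clm_apply hI using 1
  rw [← mul_apply_eq_comp (NormedSpace.exp (t • T)), hinv]
  simp

end LinearODE

theorem HasDerivAt.dotProduct {ι : Type*} [Fintype ι] {f g : ℝ → ι → ℝ} {f' g' : ι → ℝ} {t : ℝ}
    (hf : HasDerivAt f f' t) (hg : HasDerivAt g g' t) :
    HasDerivAt (fun s => f s ⬝ᵥ g s) (f' ⬝ᵥ g t + f t ⬝ᵥ g') t := by
  simp only [_root_.dotProduct, ← Finset.sum_add_distrib]
  exact HasDerivAt.fun_sum fun i _ => (hasDerivAt_pi.1 hf i).mul (hasDerivAt_pi.1 hg i)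

theorem ContinuousOn.dotProduct {ι : Type*} [Fintype ι] {f g : ℝ → ι → ℝ} {s : Set ℝ}
    (hf : ContinuousOn f s) (hg : ContinuousOn g s) : ContinuousOn (fun t => f t ⬝ᵥ g t) s :=
  continuousOn_finsetSum _ fun i _ => (continuousOn_pi.1 hf i).mul (continuousOn_pi.1 hg i)

theorem ContinuousOn.matrix_mulVec_const {ι κ : Type*} [Fintype κ] (M : Matrix ι κ ℝ)
    {f : ℝ → κ → ℝ} {s : Set ℝ} (hf : ContinuousOn f s) : ContinuousOn (fun t => M *ᵥ f t) s :=
  (continuous_const.matrix_mulVec continuous_id).comp_continuousOn hf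

/-- If a linear-quadratic real polynomial without constant term is nonnegative, its linear
coefficient vanishes. -/
theorem eq_zero_of_forall_nonneg_linear_add_sq {a b : ℝ} (h : ∀ x : ℝ, 0 ≤ x * a + x ^ 2 * b) :
    a = 0 := by
  have hd := discrim_le_zero (a := b) (b := a) (c := 0) fun x => by linarith [h x]
  simp only [discrim, mul_zero, sub_zero] at hd
  exact pow_eq_zero_iff two_ne_zero |>.1 (le_antisymm hd (sq_nonneg a))

/-- If a control `u*` globally minimizes the cost `J` over all
(continuous) controls, then the first-order necessary optimality condition
`μ u*(t) + Bᵀ p_{u*}(t) = 0` holds for every `t ∈ [0, t_f]`, where `p_{u*}` is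
the adjoint state of `u*`. -/
theorem fom_optimal_control_necessary_condition
    (m nc : ℕ) (t_f : ℝ) (ht_f : 0 < t_f)
    (A : Matrix (Fin m) (Fin m) ℝ) (B : Matrix (Fin m) (Fin nc) ℝ)
    (C : Matrix (Fin m) (Fin m) ℝ) (μ : ℝ) (hμ : 0 < μ)
    (q0 : Fin m → ℝ) (qd : ℝ → Fin m → ℝ)
    (hqd : ContinuousOn qd (Set.Icc (0:ℝ) t_f))
    -- the control `u*`, its state `q*` and its adjoint state `p`
    (ustar : ℝ → Fin nc → ℝ)
    (hustar : ContinuousOn ustar (Set.Icc (0:ℝ) t_f))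
    (qstar : ℝ → Fin m → ℝ)
    (hq0 : qstar 0 = q0)
    (hqode : ∀ t ∈ Set.Icc (0:ℝ) t_f,
      HasDerivAt qstar (A *ᵥ qstar t + B *ᵥ ustar t) t)
    (p : ℝ → Fin m → ℝ)
    (hpf : p t_f = 0)
    (hpode : ∀ t ∈ Set.Icc (0:ℝ) t_f,
      HasDerivAt p (-(Aᵀ *ᵥ p t + (Cᵀ * C) *ᵥ (qstar t - qd t))) t)
    -- `u*` is a global minimizer: `J(u*) ≤ J(v)` for every control `v`
    (hopt : ∀ v : ℝ → Fin nc → ℝ, ContinuousOn v (Set.Icc (0:ℝ) t_f) →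
      ∀ qv : ℝ → Fin m → ℝ, qv 0 = q0 →
      (∀ t ∈ Set.Icc (0:ℝ) t_f, HasDerivAt qv (A *ᵥ qv t + B *ᵥ v t) t) →
      (1/2) * (∫ t in (0:ℝ)..t_f,
          ((C *ᵥ (qstar t - qd t)) ⬝ᵥ (C *ᵥ (qstar t - qd t))
            + μ * (ustar t ⬝ᵥ ustar t)))
        ≤ (1/2) * (∫ t in (0:ℝ)..t_f,
          ((C *ᵥ (qv t - qd t)) ⬝ᵥ (C *ᵥ (qv t - qd t))
            + μ * (v t ⬝ᵥ v t)))) :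
    ∀ t ∈ Set.Icc (0:ℝ) t_f, μ • ustar t + Bᵀ *ᵥ p t = 0 := by
  set K : Set ℝ := Set.Icc 0 t_f
  have hle : (0 : ℝ) ≤ t_f := ht_f.le
  have hK : Set.uIcc 0 t_f = K := Set.uIcc_of_le hle
  have hp : ContinuousOn p K := fun t ht => (hpode t ht).continuousAt.continuousWithinAt
  have hq : ContinuousOn qstar K := fun t ht => (hqode t ht).continuousAt.continuousWithinAt
  have hgrad : ContinuousOn (fun t => μ • ustar t + Bᵀ *ᵥ p t) K :=
    (hustar.const_smul μ).add (hp.matrix_mulVec_const _)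
  -- perturb in the direction of the gradient, extended continuously to the whole line
  obtain ⟨w, hw, hwK⟩ : ∃ w : ℝ → Fin nc → ℝ, Continuous w ∧
      ∀ t ∈ K, w t = μ • ustar t + Bᵀ *ᵥ p t :=
    ⟨Set.IccExtend hle (K.domRestrict fun t => μ • ustar t + Bᵀ *ᵥ p t),
      hgrad.domRestrict.Icc_extend', fun t ht => Set.IccExtend_of_mem hle _ ht⟩
  obtain ⟨z, hz0, hz⟩ := exists_hasDerivAt_linear_ode A.mulVecLin.toContinuousLinearMap
    (continuous_const.matrix_mulVec hw : Continuous fun t => B *ᵥ w t)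
  replace hz : ∀ t, HasDerivAt z (A *ᵥ z t + B *ᵥ w t) t := hz
  have hzc : ContinuousOn z K := fun t _ => (hz t).continuousAt.continuousWithinAt
  have hwc : ContinuousOn w K := hw.continuousOn
  have hCe : ContinuousOn (fun t => C *ᵥ (qstar t - qd t)) K := (hq.sub hqd).matrix_mulVec_const C
  have hCz : ContinuousOn (fun t => C *ᵥ z t) K := hzc.matrix_mulVec_const C
  have integrable {f : ℝ → ℝ} (hf : ContinuousOn f K) : IntervalIntegrable f volume 0 t_f :=
    ContinuousOn.intervalIntegrable (hK ▸ hf)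
  have hF := integrable ((hCe.dotProduct hCe).fun_add ((hustar.dotProduct hustar).const_mul μ))
  have hL := integrable ((hCe.dotProduct hCz).fun_add ((hustar.dotProduct hwc).const_mul μ))
  have hQ := integrable ((hCz.dotProduct hCz).fun_add ((hwc.dotProduct hwc).const_mul μ))
  have hvar : ∫ t in (0 : ℝ)..t_f,
      ((C *ᵥ (qstar t - qd t)) ⬝ᵥ (C *ᵥ z t) + μ * (ustar t ⬝ᵥ w t)) = 0 := by
    refine eq_zero_of_forall_nonneg_linear_add_sq (b := (1 / 2) * ∫ t in (0 : ℝ)..t_f,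
      ((C *ᵥ z t) ⬝ᵥ (C *ᵥ z t) + μ * (w t ⬝ᵥ w t))) fun ε => ?_
    have hJ := hopt (fun t => ustar t + ε • w t) (hustar.add (hwc.const_smul ε))
      (fun t => qstar t + ε • z t) (by simp [hq0, hz0]) fun t ht => by
        refine ((hqode t ht).add ((hz t).const_smul ε)).congr_deriv ?_
        simp only [Matrix.mulVec_add, Matrix.mulVec_smul, smul_add]
        abel
    have hexpand : ∀ t, (C *ᵥ (qstar t + ε • z t - qd t)) ⬝ᵥ (C *ᵥ (qstar t + ε • z t - qd t))
          + μ * ((ustar t + ε • w t) ⬝ᵥ (ustar t + ε • w t))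
        = ((C *ᵥ (qstar t - qd t)) ⬝ᵥ (C *ᵥ (qstar t - qd t)) + μ * (ustar t ⬝ᵥ ustar t))
          + (2 * ε) * ((C *ᵥ (qstar t - qd t)) ⬝ᵥ (C *ᵥ z t) + μ * (ustar t ⬝ᵥ w t))
          + ε ^ 2 * ((C *ᵥ z t) ⬝ᵥ (C *ᵥ z t) + μ * (w t ⬝ᵥ w t)) := fun t => by
      rw [add_sub_right_comm, Matrix.mulVec_add, Matrix.mulVec_smul]
      simp only [add_dotProduct, dotProduct_add, smul_dotProduct, dotProduct_smul, smul_eq_mul,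
        dotProduct_comm (C *ᵥ z t) (C *ᵥ (qstar t - qd t)), dotProduct_comm (w t) (ustar t)]
      ring
    simp only [hexpand] at hJ
    rw [intervalIntegral.integral_add (hF.add (hL.const_mul _)) (hQ.const_mul _),
      intervalIntegral.integral_add hF (hL.const_mul _), intervalIntegral.integral_const_mul,
      intervalIntegral.integral_const_mul] at hJ
    linarith
  have hpz : ∀ t ∈ Set.uIcc 0 t_f, HasDerivAt (fun s => p s ⬝ᵥ z s)
      (w t ⬝ᵥ w t - ((C *ᵥ (qstar t - qd t)) ⬝ᵥ (C *ᵥ z t) + μ * (ustar t ⬝ᵥ w t))) t := by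
    intro t ht
    rw [hK] at ht
    refine ((hpode t ht).dotProduct (hz t)).congr_deriv ?_
    have hA : (Aᵀ *ᵥ p t) ⬝ᵥ z t = p t ⬝ᵥ (A *ᵥ z t) := by
      rw [Matrix.mulVec_transpose, Matrix.dotProduct_mulVec]
    have hB : (Bᵀ *ᵥ p t) ⬝ᵥ w t = p t ⬝ᵥ (B *ᵥ w t) := by
      rw [Matrix.mulVec_transpose, Matrix.dotProduct_mulVec]
    have hC : ((Cᵀ * C) *ᵥ (qstar t - qd t)) ⬝ᵥ z t
        = (C *ᵥ (qstar t - qd t)) ⬝ᵥ (C *ᵥ z t) := by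
      rw [← Matrix.mulVec_mulVec, Matrix.mulVec_transpose, Matrix.dotProduct_mulVec]
    have hww : w t ⬝ᵥ w t = μ * (ustar t ⬝ᵥ w t) + p t ⬝ᵥ (B *ᵥ w t) := by
      rw [← hB, ← smul_eq_mul, ← smul_dotProduct, ← add_dotProduct, ← hwK t ht]
    rw [hww, neg_dotProduct, add_dotProduct, dotProduct_add, hA, hC]
    ring
  have hW := integrable (hwc.dotProduct hwc)
  have hnorm : ∫ t in (0 : ℝ)..t_f, w t ⬝ᵥ w t = 0 := by
    have h := intervalIntegral.integral_eq_sub_of_hasDerivAt hpz (hW.sub hL)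
    rw [intervalIntegral.integral_sub hW hL, hvar, hpf, hz0] at h
    simpa using h
  have hnonneg (s : ℝ) : 0 ≤ w s ⬝ᵥ w s := Finset.sum_nonneg fun i _ => mul_self_nonneg (w s i)
  intro t ht
  rw [← hwK t ht]
  by_contra hne
  refine (intervalIntegral.integral_pos ht_f (hwc.dotProduct hwc)
    (fun s _ => hnonneg s) ⟨t, ht, ?_⟩).ne' hnorm
  exact lt_of_le_of_ne (hnonneg t) fun h => hne (dotProduct_self_eq_zero.1 h.symm)
end
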